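/- Let ξ ∈ ℝ³ be nonzero and let w₁, …, w_{m+1} ∈ ξ^⊥ be such that any two are linearly independent. Then the union over p = 0, …, m of the families { w_k^{⊙p} ⊙ ξ^{⊙(m-p)} : 1 ≤ k ≤ p+1 } spans Sym^m(ℝ³); in particular the matrix P whose columns are all tensors w_k^{⊙p} ⊙ ξ^{⊙(m-p)}, for 0 ≤ p ≤ m and 1 ≤ k ≤ m+1, has rank (m+1)(m+2)/2. -/

import Mathlib

def dot3 (u v : Fin 3 → ℝ) : ℝ := ∑ i, u i * v i

/-- The symmetric tensor w^{⊙p} ⊙ ξ^{⊙(m-p)} in Sym^m(ℝ³), modeled faithfully as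
the polynomial function y ↦ ⟨w,y⟩^p ⟨ξ,y⟩^{m-p}. -/
noncomputable def symMix (m p : ℕ) (w ξ : Fin 3 → ℝ) : (Fin 3 → ℝ) → ℝ :=
  fun y => (dot3 w y) ^ p * (dot3 ξ y) ^ (m - p)


/-- Homogeneous Vandermonde inversion: mixed monomials are combinations of pure powers. -/
lemma aux_vandermonde {R : Type*} [CommRing R] [Algebra ℝ R] (n : ℕ) (s t : Fin (n + 1) → ℝ)
    (h : ∀ i j, i ≠ j → s i * t j ≠ s j * t i) (x y : R) (a : ℕ) (ha : a ≤ n) :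
    x ^ a * y ^ (n - a) ∈ Submodule.span ℝ (Set.range fun i => (s i • x + t i • y) ^ n) := by
  set M := Matrix.projVandermonde s t with hM
  have hdet : IsUnit M.det := by
    rw [isUnit_iff_ne_zero, hM, Matrix.det_projVandermonde]
    refine Finset.prod_ne_zero_iff.mpr fun i _ => Finset.prod_ne_zero_iff.mpr fun j hj => ?_
    have hij : j ≠ i := (Finset.mem_Ioi.mp hj).ne'
    exact sub_ne_zero.mpr (h j i hij)
  set z : Fin (n + 1) → R := fun b => (n.choose b : ℝ) • (x ^ (b : ℕ) * y ^ (n - b)) with hz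
  have hpow : ∀ i, (s i • x + t i • y) ^ n = ∑ b, M i b • z b := by
    intro i
    rw [add_pow, Finset.sum_range]
    refine Finset.sum_congr rfl fun b _ => ?_
    have hr : (b.rev : ℕ) = n - b := by rw [Fin.val_rev]; omega
    simp only [hM, hz, Matrix.projVandermonde_apply, hr, smul_pow, Algebra.smul_def, map_mul,
      map_pow, map_natCast]
    ring
  set a' : Fin (n + 1) := ⟨a, by omega⟩ with ha'
  have hza : z a' = ∑ i, M⁻¹ a' i • (s i • x + t i • y) ^ n := by
    simp_rw [hpow, Finset.smul_sum, smul_smul]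
    rw [Finset.sum_comm]
    simp_rw [← Finset.sum_smul, ← Matrix.mul_apply, Matrix.nonsing_inv_mul M hdet,
      Matrix.one_apply, ite_smul, one_smul, zero_smul]
    simp
  have hc : (n.choose a : ℝ) ≠ 0 := by exact_mod_cast (Nat.choose_pos ha).ne'
  have : x ^ a * y ^ (n - a) = (n.choose a : ℝ)⁻¹ • z a' := by
    simp only [hz, ha', smul_smul, inv_mul_cancel₀ hc, one_smul]
  rw [this, hza]
  exact Submodule.smul_mem _ _ (Submodule.sum_mem _ fun i _ =>
    Submodule.smul_mem _ _ (Submodule.subset_span ⟨i, rfl⟩))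

/-- The linear form attached to a vector. -/
def dform (u : Fin 3 → ℝ) : (Fin 3 → ℝ) → ℝ := fun y => dot3 u y

lemma dform_comb (a b : ℝ) (u v : Fin 3 → ℝ) :
    dform (a • u + b • v) = a • dform u + b • dform v := by
  funext y
  simp only [dform, dot3, Pi.add_apply, Pi.smul_apply, smul_eq_mul, Fin.sum_univ_three]
  ring

lemma symMix_eq (m p : ℕ) (u v : Fin 3 → ℝ) :
    symMix m p u v = dform u ^ p * dform v ^ (m - p) := rfl

/-- The span of all pure powers. -/
def pureSpan (m : ℕ) : Submodule ℝ ((Fin 3 → ℝ) → ℝ) :=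
  Submodule.span ℝ {f : (Fin 3 → ℝ) → ℝ | ∃ v : Fin 3 → ℝ, f = fun y => (dot3 v y) ^ m}

lemma pow_mem_pureSpan (m : ℕ) (v : Fin 3 → ℝ) : dform v ^ m ∈ pureSpan m :=
  Submodule.subset_span ⟨v, rfl⟩

lemma mixed_mem_span (n a : ℕ) (ha : a ≤ n) (u v : Fin 3 → ℝ) :
    dform u ^ a * dform v ^ (n - a) ∈ pureSpan n := by
  have := aux_vandermonde n (fun _ => 1) (fun i => (i : ℝ))
    (by
      intro i j hij h
      apply hij
      simp only [one_mul] at h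
      exact Fin.ext (by exact_mod_cast h.symm)) (dform u) (dform v) a ha
  refine Submodule.span_le.mpr ?_ this
  rintro _ ⟨i, rfl⟩
  simp only [← dform_comb]
  exact pow_mem_pureSpan _ _

lemma mul_mem_pureSpan (m p : ℕ) (hp : p ≤ m) (v : Fin 3 → ℝ) (f : (Fin 3 → ℝ) → ℝ)
    (hf : f ∈ pureSpan p) : f * dform v ^ (m - p) ∈ pureSpan m := by
  induction hf using Submodule.span_induction with
  | mem x hx =>
    obtain ⟨u, rfl⟩ := hx
    exact mixed_mem_span m p hp u v
  | zero => simp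
  | add x y _ _ hx hy => rw [add_mul]; exact add_mem hx hy
  | smul a x _ hx => rw [smul_mul_assoc]; exact Submodule.smul_mem _ _ hx

lemma exists_coords (ξ w0 w1 : Fin 3 → ℝ) (hξ : ξ ≠ 0) (h0 : dot3 w0 ξ = 0) (h1 : dot3 w1 ξ = 0)
    (hl : LinearIndependent ℝ ![w0, w1]) (v : Fin 3 → ℝ) :
    ∃ a b c : ℝ, v = a • w0 + b • w1 + c • ξ := by
  have hpos : dot3 ξ ξ ≠ 0 := by
    intro h
    apply hξ
    have := (Finset.sum_eq_zero_iff_of_nonneg (fun i _ => mul_self_nonneg (ξ i))).mp h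
    funext i
    simpa using this i (Finset.mem_univ i)
  have hli : LinearIndependent ℝ ![w0, w1, ξ] := by
    rw [Fintype.linearIndependent_iff]
    intro g hg
    simp only [Fin.sum_univ_three, Matrix.cons_val] at hg
    have hd : g 0 * dot3 w0 ξ + g 1 * dot3 w1 ξ + g 2 * dot3 ξ ξ = 0 := by
      have e0 := congrFun hg 0
      have e1 := congrFun hg 1
      have e2 := congrFun hg 2
      simp only [Pi.add_apply, Pi.smul_apply, smul_eq_mul, Pi.zero_apply] at e0 e1 e2
      simp only [dot3, Fin.sum_univ_three]
      linear_combination ξ 0 * e0 + ξ 1 * e1 + ξ 2 * e2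
    rw [h0, h1] at hd
    have h2 : g 2 = 0 := by simpa [hpos] using hd
    rw [h2, zero_smul, add_zero] at hg
    obtain ⟨ha, hb⟩ := LinearIndependent.pair_iff.mp hl _ _ hg
    intro i
    fin_cases i <;> assumption
  have hsp := hli.span_eq_top_of_card_eq_finrank' (by simp)
  have hv : v ∈ Submodule.span ℝ (Set.range ![w0, w1, ξ]) := by rw [hsp]; trivial
  obtain ⟨c, hc⟩ := (Submodule.mem_span_range_iff_exists_fun ℝ).mp hv
  refine ⟨c 0, c 1, c 2, ?_⟩
  rw [← hc]
  simp [Fin.sum_univ_three]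

lemma exists_coords_perp (ξ w0 w1 : Fin 3 → ℝ) (hξ : ξ ≠ 0) (h0 : dot3 w0 ξ = 0)
    (h1 : dot3 w1 ξ = 0)
    (hl : LinearIndependent ℝ ![w0, w1]) (v : Fin 3 → ℝ) (hv : dot3 v ξ = 0) :
    ∃ a b : ℝ, v = a • w0 + b • w1 := by
  obtain ⟨a, b, c, rfl⟩ := exists_coords ξ w0 w1 hξ h0 h1 hl v
  have hd : a * dot3 w0 ξ + b * dot3 w1 ξ + c * dot3 ξ ξ = 0 := by
    rw [← hv]
    simp only [dot3, Fin.sum_univ_three, Pi.add_apply, Pi.smul_apply, smul_eq_mul]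
    ring
  have hpos : dot3 ξ ξ ≠ 0 := by
    intro h
    apply hξ
    have := (Finset.sum_eq_zero_iff_of_nonneg (fun i _ => mul_self_nonneg (ξ i))).mp h
    funext i
    simpa using this i (Finset.mem_univ i)
  rw [h0, h1] at hd
  have h2 : c = 0 := by simpa [hpos] using hd
  exact ⟨a, b, by simp [h2]⟩

lemma pow_mem_span_pow (p : ℕ) (w : Fin (p + 1) → Fin 3 → ℝ) (w0 w1 : Fin 3 → ℝ)
    (hpair : ∀ i j, i ≠ j → LinearIndependent ℝ ![w i, w j])
    (hw : ∀ k, ∃ a b : ℝ, w k = a • w0 + b • w1) (a b : ℝ) :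
    dform (a • w0 + b • w1) ^ p ∈ Submodule.span ℝ (Set.range fun k => dform (w k) ^ p) := by
  choose s t hst using hw
  have hne : ∀ i j, i ≠ j → s i * t j ≠ s j * t i := by
    intro i j hij h
    have hp := LinearIndependent.pair_iff.mp (hpair i j hij)
    have e1 := hp (t j) (-t i) (by
      rw [hst i, hst j]
      funext l
      simp only [Pi.add_apply, Pi.smul_apply, smul_eq_mul, Pi.zero_apply]
      linear_combination w0 l * h)
    have e2 := hp (s j) (-s i) (by
      rw [hst i, hst j]
      funext l
      simp only [Pi.add_apply, Pi.smul_apply, smul_eq_mul, Pi.zero_apply]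
      linear_combination - w1 l * h)
    have hwi : w i = 0 := by
      rw [hst i, neg_eq_zero.mp e1.2, neg_eq_zero.mp e2.2]; simp
    have := hp 1 0 (by simp [hwi])
    exact one_ne_zero this.1
  have key := aux_vandermonde p s t hne (dform w0) (dform w1)
  simp only [← dform_comb, ← hst] at key
  rw [dform_comb, add_pow]
  refine Submodule.sum_mem _ fun c hc => ?_
  have := Submodule.smul_mem _ ((a ^ c * b ^ (p - c)) * (p.choose c : ℝ))
    (key c (by simpa [Nat.lt_succ_iff] using hc))
  convert this using 1
  simp only [smul_pow, Algebra.smul_def, map_mul, map_pow, map_natCast]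
  ring

lemma card_sigma_tri (m : ℕ) :
    Fintype.card (Σ p : Fin (m + 1), Fin (p.val + 1)) = (m + 1) * (m + 2) / 2 := by
  rw [Fintype.card_sigma]
  simp only [Fintype.card_fin]
  rw [← Finset.sum_range (fun i => i + 1)]
  have := Finset.sum_range_succ' (fun i => i) (m + 1)
  rw [add_zero] at this
  rw [← this, Finset.sum_range_id]
  simp [mul_comm]

/-- Exponents of the coordinate monomials. -/
noncomputable def triExp (m : ℕ) (pk : Σ p : Fin (m + 1), Fin (p.val + 1)) : Fin 3 →₀ ℕ :=
  Finsupp.equivFunOnFinite.symm ![pk.2.val, pk.1.val - pk.2.val, m - pk.1.val]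

lemma triExp_injective (m : ℕ) : Function.Injective (triExp m) := by
  rintro ⟨⟨p, hp⟩, ⟨k, hk⟩⟩ ⟨⟨q, hq⟩, ⟨l, hl⟩⟩ h
  have h' := Finsupp.equivFunOnFinite.symm.injective h
  have e0 := congrFun h' 0
  have e2 := congrFun h' 2
  simp only [Matrix.cons_val] at e0 e2
  have : p = q := by omega
  subst this
  subst e0
  rfl

lemma monomials_li (m : ℕ) : LinearIndependent ℝ
    (fun pk => fun y : Fin 3 → ℝ =>
      MvPolynomial.eval y (MvPolynomial.monomial (triExp m pk) (1 : ℝ))) := by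
  let E : MvPolynomial (Fin 3) ℝ →ₗ[ℝ] ((Fin 3 → ℝ) → ℝ) :=
    { toFun := fun q y => MvPolynomial.eval y q
      map_add' := fun a b => by funext y; simp
      map_smul' := fun a b => by funext y; simp [MvPolynomial.smul_eval] }
  have hE : LinearMap.ker E = ⊥ := by
    rw [LinearMap.ker_eq_bot]
    intro a b hab
    exact MvPolynomial.funext fun y => congrFun hab y
  have h1 := (MvPolynomial.basisMonomials (Fin 3) ℝ).linearIndependent.comp _ (triExp_injective m)
  have h2 := h1.map' E hE
  have he : (fun pk => fun y : Fin 3 → ℝ =>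
      MvPolynomial.eval y (MvPolynomial.monomial (triExp m pk) (1 : ℝ))) =
      (E ∘ (MvPolynomial.basisMonomials (Fin 3) ℝ) ∘ triExp m) := by
    funext pk y
    simp [E]
  rw [he]
  exact h2

lemma monomial_mem (m : ℕ) (pk : Σ p : Fin (m + 1), Fin (p.val + 1)) :
    (fun y : Fin 3 → ℝ => MvPolynomial.eval y (MvPolynomial.monomial (triExp m pk) (1 : ℝ)))
      ∈ pureSpan m := by
  have h := mul_mem_pureSpan m pk.1.val (by omega) (Pi.single 2 1) _
    (mixed_mem_span pk.1.val pk.2.val (by omega) (Pi.single 0 1) (Pi.single 1 1))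
  convert h using 1
  funext y
  simp [MvPolynomial.eval_monomial, triExp, dform, dot3, Fin.prod_univ_three,
    Finsupp.prod_fintype, Pi.single_apply]

/-- For ξ ≠ 0 and w₁,…,w_{m+1} ∈ ξ^⊥ pairwise linearly independent, the union over
p of {w_k^{⊙p} ⊙ ξ^{⊙(m-p)} : 1 ≤ k ≤ p+1} spans Sym^m(ℝ³) (the span of all pure
m-th powers), and the full family of such tensors has rank (m+1)(m+2)/2. -/
theorem symMix_span_and_rank (m : ℕ) (ξ : Fin 3 → ℝ) (hξ : ξ ≠ 0)
    (w : Fin (m + 1) → Fin 3 → ℝ)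
    (hperp : ∀ k, dot3 (w k) ξ = 0)
    (hpair : ∀ i j, i ≠ j → LinearIndependent ℝ ![w i, w j]) :
    Submodule.span ℝ (Set.range fun pk : Σ p : Fin (m + 1), Fin (p.val + 1) =>
        symMix m pk.1.val (w (Fin.castLE (Nat.succ_le_succ pk.1.is_le) pk.2)) ξ) =
      Submodule.span ℝ {f : (Fin 3 → ℝ) → ℝ | ∃ v : Fin 3 → ℝ, f = fun y => (dot3 v y) ^ m} ∧
    Module.finrank ℝ
      ↥(Submodule.span ℝ (Set.range fun pk : Fin (m + 1) × Fin (m + 1) =>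
          symMix m pk.1.val (w pk.2) ξ)) = (m + 1) * (m + 2) / 2 := by
  set A := Submodule.span ℝ (Set.range fun pk : Σ p : Fin (m + 1), Fin (p.val + 1) =>
        symMix m pk.1.val (w (Fin.castLE (Nat.succ_le_succ pk.1.is_le) pk.2)) ξ) with hA
  set B := Submodule.span ℝ (Set.range fun pk : Fin (m + 1) × Fin (m + 1) =>
          symMix m pk.1.val (w pk.2) ξ) with hB
  change A = pureSpan m ∧ _
  have hAB : A ≤ B := by
    refine Submodule.span_le.mpr ?_
    rintro _ ⟨pk, rfl⟩
    exact Submodule.subset_span ⟨(pk.1, Fin.castLE (Nat.succ_le_succ pk.1.is_le) pk.2), rfl⟩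
  have hBS : B ≤ pureSpan m := by
    refine Submodule.span_le.mpr ?_
    rintro _ ⟨pk, rfl⟩
    exact mixed_mem_span m pk.1.val pk.1.is_le _ _
  have hpowA : ∀ (p : ℕ) (hp : p ≤ m) (f : (Fin 3 → ℝ) → ℝ),
      f ∈ Submodule.span ℝ (Set.range fun k : Fin (p + 1) =>
        dform (w (Fin.castLE (Nat.succ_le_succ hp) k)) ^ p) → f * dform ξ ^ (m - p) ∈ A := by
    intro p hp f hf
    induction hf using Submodule.span_induction with
    | mem x hx =>
      obtain ⟨k, rfl⟩ := hx
      exact Submodule.subset_span ⟨⟨⟨p, by omega⟩, k⟩, rfl⟩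
    | zero => simp
    | add x y _ _ hx hy => rw [add_mul]; exact add_mem hx hy
    | smul a x _ hx => rw [smul_mul_assoc]; exact Submodule.smul_mem _ _ hx
  have hSA : pureSpan m ≤ A := by
    refine Submodule.span_le.mpr ?_
    rintro _ ⟨v, rfl⟩
    change dform v ^ m ∈ A
    rcases Nat.eq_zero_or_pos m with hm | hm
    · subst hm
      exact Submodule.subset_span ⟨⟨0, 0⟩, by simp [symMix_eq]⟩
    · have h01 : (⟨0, by omega⟩ : Fin (m + 1)) ≠ ⟨1, by omega⟩ := by simp
      have hl := hpair _ _ h01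
      obtain ⟨a, b, c, hv⟩ := exists_coords ξ _ _ hξ (hperp _) (hperp _) hl v
      have hv' : v = (1 : ℝ) • (a • w ⟨0, by omega⟩ + b • w ⟨1, by omega⟩) + c • ξ := by
        rw [one_smul]; exact hv
      rw [hv', dform_comb, one_smul, add_pow]
      refine Submodule.sum_mem _ fun p hp => ?_
      have hp' : p ≤ m := by simpa [Nat.lt_succ_iff] using hp
      have h1 := pow_mem_span_pow p (fun k => w (Fin.castLE (Nat.succ_le_succ hp') k)) _ _
        (fun i j hij => hpair _ _ (fun h => hij (Fin.castLE_injective _ h)))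
        (fun k => exists_coords_perp ξ _ _ hξ (hperp _) (hperp _) hl _ (hperp _)) a b
      have h2 := Submodule.smul_mem _ (c ^ (m - p) * (m.choose p : ℝ)) (hpowA p hp' _ h1)
      convert h2 using 1
      simp only [smul_pow, Algebra.smul_def, map_mul, map_pow, map_natCast]
      ring
  have hAS : A = pureSpan m := le_antisymm (hAB.trans hBS) hSA
  have hBA : B = A := le_antisymm (hBS.trans hSA) hAB
  refine ⟨hAS, ?_⟩
  rw [hBA]
  haveI : FiniteDimensional ℝ A := FiniteDimensional.span_of_finite ℝ (Set.finite_range _)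
  rw [← card_sigma_tri m]
  refine le_antisymm (finrank_range_le_card _) ?_
  rw [← finrank_span_eq_card (monomials_li m)]
  refine Submodule.finrank_mono ?_
  rw [hAS]
  refine Submodule.span_le.mpr ?_
  rintro _ ⟨pk, rfl⟩
  exact monomial_mem m pk
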